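/- arXiv:2503.16813 — 2 statements merged into one kernel-verified Lean document; each statement's English description precedes it below -/
import Mathlib

section
/- Let α > 0, let d ≥ 1 be an integer, and let r > 0 be a real number. Let (Ū, S̄) : [ξ₀, ∞) → ℝ² be a C¹ solution of the system (⋆) such that (Ū(ξ), S̄(ξ)) → (0, 0) as ξ → ∞. Then there exists a constant C > 0 such that |Ū(ξ)| + |S̄(ξ)| ≤ C e^{−rξ} for all ξ ≥ ξ₀. -/
/-- `D(u,s) = (1+u)² + α² s²`. -/
noncomputable def Dfun (α u s : ℝ) : ℝ := (1 + u) ^ 2 + α ^ 2 * s ^ 2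

/-- `N_U(u,s) = -α² d s² u - α (r-1) s² - u (u+1) (r+u)`. -/
noncomputable def NU (α : ℝ) (d : ℕ) (r u s : ℝ) : ℝ :=
  -α ^ 2 * d * s ^ 2 * u - α * (r - 1) * s ^ 2 - u * (u + 1) * (r + u)

/-- `N_S(u,s) = -α² s³ + (αr - αd - r - 1) s u + (α - αd - 1) s u² - r s`. -/
noncomputable def NS (α : ℝ) (d : ℕ) (r u s : ℝ) : ℝ :=
  -α ^ 2 * s ^ 3 + (α * r - α * d - r - 1) * s * u + (α - α * d - 1) * s * u ^ 2 - r * s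

lemma quad_bound (c1 c2 c3 u s m : ℝ) (hu : |u| ≤ m) (hs : |s| ≤ m) (hm : m ≤ 1/2) :
    c1 * u + c2 * u ^ 2 + c3 * s ^ 2 ≤ (|c1| + |c2| + |c3|) * m := by
  have hm0 : 0 ≤ m := (abs_nonneg u).trans hu
  have h1 : c1 * u ≤ |c1| * m :=
    (le_abs_self _).trans (by rw [abs_mul]; gcongr)
  have hu2 : u ^ 2 ≤ m := by
    rw [← sq_abs]; nlinarith [abs_nonneg u]
  have hs2 : s ^ 2 ≤ m := by
    rw [← sq_abs]; nlinarith [abs_nonneg s]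
  have h2 : c2 * u ^ 2 ≤ |c2| * m := by
    have : c2 * u ^ 2 ≤ |c2| * u ^ 2 := by gcongr; exact le_abs_self _
    exact this.trans (by gcongr)
  have h3 : c3 * s ^ 2 ≤ |c3| * m := by
    have : c3 * s ^ 2 ≤ |c3| * s ^ 2 := by gcongr; exact le_abs_self _
    exact this.trans (by gcongr)
  linarith

lemma field_bound (α : ℝ) (d : ℕ) (r : ℝ) : ∃ K : ℝ, 0 < K ∧ ∀ u s m : ℝ,
    |u| ≤ m → |s| ≤ m → m ≤ 1/2 →
    2 * u * (NU α d r u s / Dfun α u s) + 2 * s * (NS α d r u s / Dfun α u s)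
      ≤ (-2 * r + K * m) * (u ^ 2 + s ^ 2) := by
  obtain ⟨L, hL0, hL⟩ : ∃ L : ℝ, 0 < L ∧ ∀ u s m : ℝ,
    |u| ≤ m → |s| ≤ m → m ≤ 1/2 →
    u * NU α d r u s + s * NS α d r u s + r * (u ^ 2 + s ^ 2) * Dfun α u s
      ≤ L * m * (u ^ 2 + s ^ 2) := by
    set P := |r - 1| + |r - 1| + |r * α ^ 2 - α ^ 2 * d| with hP
    set Q := |(α * r - α * d - r - 1) - α * (r - 1) + 2 * r| + |(α - α * d - 1) + r|
      + |r * α ^ 2 - α ^ 2| with hQ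
    have hP0 : 0 ≤ P := by positivity
    have hQ0 : 0 ≤ Q := by positivity
    refine ⟨P + Q + 1, by positivity, fun u s m hu hs hm => ?_⟩
    have hm0 : 0 ≤ m := (abs_nonneg u).trans hu
    have h1 := quad_bound (r - 1) (r - 1) (r * α ^ 2 - α ^ 2 * d) u s m hu hs hm
    have h2 := quad_bound ((α * r - α * d - r - 1) - α * (r - 1) + 2 * r)
      ((α - α * d - 1) + r) (r * α ^ 2 - α ^ 2) u s m hu hs hm
    rw [← hP] at h1
    rw [← hQ] at h2
    have e1 := mul_le_mul_of_nonneg_left h1 (sq_nonneg u)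
    have e2 := mul_le_mul_of_nonneg_left h2 (sq_nonneg s)
    have e3 : 0 ≤ u ^ 2 * ((Q + 1) * m) := by positivity
    have e4 : 0 ≤ s ^ 2 * ((P + 1) * m) := by positivity
    unfold NU NS Dfun
    linarith
  refine ⟨8 * L, by positivity, fun u s m hu hs hm => ?_⟩
  have hm0 : 0 ≤ m := (abs_nonneg u).trans hu
  have hD : 1 / 4 ≤ Dfun α u s := by
    unfold Dfun
    have := (abs_le.mp (hu.trans hm)).1
    nlinarith [mul_nonneg (sq_nonneg α) (sq_nonneg s)]
  have hD0 : 0 < Dfun α u s := by linarith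
  have h := hL u s m hu hs hm
  have e : 2 * u * (NU α d r u s / Dfun α u s) + 2 * s * (NS α d r u s / Dfun α u s)
      = (2 * (u * NU α d r u s + s * NS α d r u s)) / Dfun α u s := by ring
  rw [e, div_le_iff₀ hD0]
  have : 0 ≤ (L * m * (u ^ 2 + s ^ 2)) * (Dfun α u s - 1 / 4) :=
    mul_nonneg (by positivity) (by linarith)
  linarith

lemma gronwall_aux (E dE φ dφ : ℝ → ℝ) (T : ℝ)
    (hE : ∀ x, T ≤ x → HasDerivAt E (dE x) x) (hφ : ∀ x, HasDerivAt φ (dφ x) x)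
    (h : ∀ x, T ≤ x → dE x ≤ dφ x * E x) :
    ∀ x, T ≤ x → E x ≤ E T * Real.exp (-φ T) * Real.exp (φ x) := by
  have hd : ∀ x, T ≤ x → HasDerivAt (fun y => E y * Real.exp (-φ y))
      (dE x * Real.exp (-φ x) + E x * (Real.exp (-φ x) * (-dφ x))) x :=
    fun x hx => (hE x hx).mul ((hφ x).neg.exp)
  have hanti : AntitoneOn (fun y => E y * Real.exp (-φ y)) (Set.Ici T) := by
    apply antitoneOn_of_deriv_nonpos (convex_Ici T)
    · exact fun x hx => (hd x hx).continuousAt.continuousWithinAt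
    · intro x hx
      rw [interior_Ici] at hx
      exact (hd x (le_of_lt hx)).differentiableAt.differentiableWithinAt
    · intro x hx
      rw [interior_Ici] at hx
      rw [(hd x (le_of_lt hx)).deriv]
      have := mul_le_mul_of_nonneg_right (h x (le_of_lt hx)) (Real.exp_pos (-φ x)).le
      linarith
  intro x hx
  have h1 : E x * Real.exp (-φ x) ≤ E T * Real.exp (-φ T) :=
    hanti (Set.mem_Ici.mpr le_rfl) (Set.mem_Ici.mpr hx) hx
  have h2 := mul_le_mul_of_nonneg_right h1 (Real.exp_pos (φ x)).le
  rwa [mul_assoc, ← Real.exp_add, neg_add_cancel, Real.exp_zero, mul_one] at h2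

/-- Exponential decay rate at the focus: a `C¹` solution of (⋆) on `[ξ₀, ∞)`
converging to `(0,0)` as `ξ → ∞` satisfies `|Ū(ξ)| + |S̄(ξ)| ≤ C e^{-rξ}`. -/
theorem decay_rate_at_focus
    (α : ℝ) (hα : 0 < α) (d : ℕ) (hd : 1 ≤ d) (r : ℝ) (hr : 0 < r)
    (ξ₀ : ℝ) (U S : ℝ → ℝ)
    (hsol : ∀ ξ : ℝ, ξ₀ ≤ ξ →
      HasDerivAt U (NU α d r (U ξ) (S ξ) / Dfun α (U ξ) (S ξ)) ξ ∧
      HasDerivAt S (NS α d r (U ξ) (S ξ) / Dfun α (U ξ) (S ξ)) ξ)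
    (htend : Filter.Tendsto (fun ξ => (U ξ, S ξ)) Filter.atTop (nhds ((0 : ℝ), (0 : ℝ)))) :
    ∃ C : ℝ, 0 < C ∧ ∀ ξ : ℝ, ξ₀ ≤ ξ → |U ξ| + |S ξ| ≤ C * Real.exp (-r * ξ) := by
  obtain ⟨K, hK, hfield⟩ := field_bound α d r
  set E : ℝ → ℝ := fun x => U x ^ 2 + S x ^ 2 with hEdef
  set dE : ℝ → ℝ := fun x => 2 * U x * (NU α d r (U x) (S x) / Dfun α (U x) (S x))
    + 2 * S x * (NS α d r (U x) (S x) / Dfun α (U x) (S x)) with hdEdef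
  have hE0 : ∀ x, 0 ≤ E x := fun x => by positivity
  have hEd : ∀ x, ξ₀ ≤ x → HasDerivAt E (dE x) x := by
    intro x hx
    have := ((hsol x hx).1.pow 2).add ((hsol x hx).2.pow 2)
    refine HasDerivAt.congr_deriv (f := E) this ?_
    simp [hdEdef]
  have hUt : Filter.Tendsto U Filter.atTop (nhds 0) :=
    (continuous_fst.tendsto ((0 : ℝ), (0 : ℝ))).comp htend
  have hSt : Filter.Tendsto S Filter.atTop (nhds 0) :=
    (continuous_snd.tendsto ((0 : ℝ), (0 : ℝ))).comp htend
  have hsq : Filter.Tendsto (fun x => Real.sqrt (E x)) Filter.atTop (nhds 0) := by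
    have := ((hUt.pow 2).add (hSt.pow 2)).sqrt
    simpa using this
  have hev : ∀ᶠ x in Filter.atTop, Real.sqrt (E x) < min (1 / 2) (r / K) :=
    hsq.eventually_lt_const (by positivity)
  obtain ⟨T₀, hT₀⟩ := Filter.eventually_atTop.mp hev
  set T := max T₀ ξ₀ with hT
  have hTξ : ξ₀ ≤ T := le_max_right _ _
  have hsmall : ∀ x, T ≤ x → Real.sqrt (E x) < min (1 / 2) (r / K) :=
    fun x hx => hT₀ x ((le_max_left _ _).trans hx)
  have hUE : ∀ x, |U x| ≤ Real.sqrt (E x) := fun x =>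
    Real.abs_le_sqrt (by simp only [hEdef]; nlinarith [sq_nonneg (S x)])
  have hSE : ∀ x, |S x| ≤ Real.sqrt (E x) := fun x =>
    Real.abs_le_sqrt (by simp only [hEdef]; nlinarith [sq_nonneg (U x)])
  have hineq : ∀ x, T ≤ x → dE x ≤ (-2 * r + K * Real.sqrt (E x)) * E x := fun x hx =>
    hfield _ _ _ (hUE x) (hSE x) ((hsmall x hx).le.trans (min_le_left _ _))
  -- first, non-sharp decay
  have step1 := gronwall_aux E dE (fun x => -r * x) (fun _ => -r) T
    (fun x hx => hEd x (hTξ.trans hx))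
    (fun x => by simpa using (hasDerivAt_id x).const_mul (-r))
    (fun x hx => by
      have h1 : Real.sqrt (E x) ≤ r / K := (hsmall x hx).le.trans (min_le_right _ _)
      rw [le_div_iff₀ hK] at h1
      exact (hineq x hx).trans (mul_le_mul_of_nonneg_right (by linarith) (hE0 x)))
  set A := E T * Real.exp (-(-r * T)) with hA
  have hA0 : 0 ≤ A := mul_nonneg (hE0 T) (Real.exp_pos _).le
  have hsqb : ∀ x, T ≤ x → Real.sqrt (E x) ≤ Real.sqrt A * Real.exp (-(r / 2) * x) := by
    intro x hx
    apply Real.sqrt_le_iff.mpr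
    refine ⟨by positivity, (step1 x hx).trans (le_of_eq ?_)⟩
    rw [mul_pow, Real.sq_sqrt hA0, ← Real.exp_nat_mul]
    congr 2
    push_cast
    ring
  set B := K * Real.sqrt A with hB
  have hB0 : 0 ≤ B := by positivity
  have step2 := gronwall_aux E dE
    (fun x => -2 * r * x - 2 * B / r * Real.exp (-(r / 2) * x))
    (fun x => -2 * r + B * Real.exp (-(r / 2) * x)) T
    (fun x hx => hEd x (hTξ.trans hx))
    (fun x => by
      have h1 := (hasDerivAt_id x).const_mul (-2 * r)
      have h2 := (((hasDerivAt_id x).const_mul (-(r / 2))).exp).const_mul (2 * B / r)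
      have h3 := h1.sub h2
      refine HasDerivAt.congr_deriv h3 ?_
      simp only [id]
      field_simp
      ring)
    (fun x hx => by
      refine (hineq x hx).trans (mul_le_mul_of_nonneg_right ?_ (hE0 x))
      have := mul_le_mul_of_nonneg_left (hsqb x hx) hK.le
      rw [hB]
      linarith)
  set M := E T * Real.exp (-(-2 * r * T - 2 * B / r * Real.exp (-(r / 2) * T))) with hM
  have hM0 : 0 ≤ M := mul_nonneg (hE0 T) (Real.exp_pos _).le
  have hfin : ∀ x, T ≤ x → Real.sqrt (E x) ≤ Real.sqrt M * Real.exp (-r * x) := by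
    intro x hx
    apply Real.sqrt_le_iff.mpr
    refine ⟨by positivity, (step2 x hx).trans ?_⟩
    rw [mul_pow, Real.sq_sqrt hM0, ← Real.exp_nat_mul]
    apply mul_le_mul_of_nonneg_left _ hM0
    apply Real.exp_le_exp.mpr
    have : 0 ≤ 2 * B / r * Real.exp (-(r / 2) * x) := by positivity
    push_cast
    linarith
  -- compact part
  have hcont : ContinuousOn (fun x => (|U x| + |S x|) * Real.exp (r * x)) (Set.Icc ξ₀ T) := by
    intro x hx
    have h1 := (hsol x hx.1).1.continuousAt
    have h2 := (hsol x hx.1).2.continuousAt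
    have h3 : ContinuousAt (fun x => Real.exp (r * x)) x := by fun_prop
    exact ((h1.abs.add h2.abs).mul h3).continuousWithinAt
  obtain ⟨C₁, hC₁⟩ := isCompact_Icc.bddAbove_image hcont
  refine ⟨|C₁| + 2 * Real.sqrt M + 1, by positivity, fun x hx => ?_⟩
  have hep := Real.exp_pos (-r * x)
  have hs0 := Real.sqrt_nonneg M
  rcases le_total T x with hTx | hxT
  · have h1 := hUE x
    have h2 := hSE x
    have h3 := hfin x hTx
    have : 0 ≤ (|C₁| + 1) * Real.exp (-r * x) := by positivity
    linarith
  · have h1 : (|U x| + |S x|) * Real.exp (r * x) ≤ C₁ :=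
      hC₁ (Set.mem_image_of_mem _ ⟨hx, hxT⟩)
    have h2 := mul_le_mul_of_nonneg_right h1 hep.le
    rw [mul_assoc, ← Real.exp_add, show r * x + -r * x = 0 by ring, Real.exp_zero, mul_one] at h2
    refine h2.trans (mul_le_mul_of_nonneg_right ?_ hep.le)
    linarith [le_abs_self C₁]
end

section
/- Let d ≥ 1 be an integer, p ≥ 3 an odd natural number, α = (p−1)/4, and let r be a real number with r > 1 and αd > r−1. Then the smooth self-similar profile (U_R, S) of the main theorem can be chosen so that, in addition, there exists a constant C > 0 with |U_R(ζ)| + |S(ζ)| ≤ C ζ^{−(r−1)} for all ζ ≥ 1. -/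
section Aux
open Set Filter Topology
open scoped BoundedContinuousFunction

/-- Global solution of a Volterra type integral equation by the Banach fixed point theorem in a
weighted space, with symmetry. -/
theorem volterra_exists {E : Type*} [NormedAddCommGroup E] [NormedSpace ℝ E] [CompleteSpace E]
    (R : ℝ → ℝ → E → E) (hR : Continuous fun q : ℝ × ℝ × E => R q.1 q.2.1 q.2.2)
    (L M : ℝ) (hL : 0 < L) (hM : 0 ≤ M)
    (hlip : ∀ σ ∈ Icc (0:ℝ) 1, ∀ t Y Z, ‖R σ t Y - R σ t Z‖ ≤ L * ‖Y - Z‖)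
    (hbd : ∀ σ ∈ Icc (0:ℝ) 1, ∀ t Y, ‖R σ t Y‖ ≤ M)
    (hodd : ∀ σ t Y, R σ (-t) Y = - R σ t Y) (Y0 : E) :
    ∃ Y : ℝ → E, Continuous Y ∧ (∀ t, Y (-t) = Y t) ∧
      ∀ t, Y t = Y0 + t • ∫ σ in (0:ℝ)..1, R σ (t * σ) (Y (t * σ)) := by
  classical
  set l : ℝ := 2 * L with hl
  have hlpos : 0 < l := by positivity
  let Yf : (ℝ →ᵇ E) → ℝ → E := fun f t => Real.exp (l * |t|) • f t
  have hYc : ∀ f : ℝ →ᵇ E, Continuous (Yf f) := by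
    intro f
    have := f.continuous
    fun_prop
  have hIntCont : ∀ f : ℝ →ᵇ E, ∀ t, Continuous fun σ => R σ (t * σ) (Yf f (t * σ)) := by
    intro f t
    have h1 := hYc f
    exact hR.comp (by fun_prop : Continuous fun σ : ℝ => (σ, t * σ, Yf f (t * σ)))
  let I : (ℝ →ᵇ E) → ℝ → E := fun f t => Y0 + t • ∫ σ in (0:ℝ)..1, R σ (t * σ) (Yf f (t * σ))
  have hIc : ∀ f, Continuous (I f) := by
    intro f
    have h1 := hYc f
    have h2 : Continuous (fun q : ℝ × ℝ => R q.2 (q.1 * q.2) (Yf f (q.1 * q.2))) :=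
      hR.comp (by fun_prop : Continuous fun q : ℝ × ℝ => (q.2, q.1 * q.2, Yf f (q.1 * q.2)))
    have h3 := intervalIntegral.continuous_parametric_intervalIntegral_of_continuous'
      (μ := MeasureTheory.volume)
      (f := fun t σ => R σ (t * σ) (Yf f (t * σ))) h2 0 1
    exact continuous_const.add (continuous_id.smul h3)
  have hexp_le : ∀ t : ℝ, |t| * Real.exp (-(l * |t|)) ≤ 1 / l := by
    intro t
    rw [le_div_iff₀ hlpos, Real.exp_neg]
    have h1 := Real.add_one_le_exp (l * |t|)
    have h2 := Real.exp_pos (l * |t|)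
    rw [show |t| * (Real.exp (l * |t|))⁻¹ * l = (l * |t|) / Real.exp (l * |t|) by
      field_simp]
    rw [div_le_one h2]; linarith
  have hbdI : ∀ f : ℝ →ᵇ E, ∀ t, ‖∫ σ in (0:ℝ)..1, R σ (t * σ) (Yf f (t * σ))‖ ≤ M := by
    intro f t
    have := intervalIntegral.norm_integral_le_of_norm_le_const (a := (0:ℝ)) (b := 1) (C := M)
      (f := fun σ => R σ (t * σ) (Yf f (t * σ))) (by
        intro σ hσ
        rw [uIoc_of_le zero_le_one] at hσ
        exact hbd σ ⟨hσ.1.le, hσ.2⟩ _ _)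
    simpa using this
  let T : (ℝ →ᵇ E) → (ℝ →ᵇ E) := fun f =>
    BoundedContinuousFunction.ofNormedAddCommGroup (fun t => Real.exp (-(l * |t|)) • I f t)
      (by have := hIc f; fun_prop) (‖Y0‖ + M * (1 / l)) (by
        intro t
        rw [norm_smul, Real.norm_of_nonneg (Real.exp_pos _).le]
        have h1 : ‖I f t‖ ≤ ‖Y0‖ + |t| * M := by
          refine (norm_add_le _ _).trans ?_
          rw [norm_smul, Real.norm_eq_abs]
          have := hbdI f t
          gcongr
        have h2 : Real.exp (-(l * |t|)) ≤ 1 := by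
          rw [Real.exp_le_one_iff]; have := abs_nonneg t; nlinarith
        calc Real.exp (-(l * |t|)) * ‖I f t‖ ≤ Real.exp (-(l * |t|)) * (‖Y0‖ + |t| * M) := by
              gcongr
          _ = Real.exp (-(l * |t|)) * ‖Y0‖ + M * (|t| * Real.exp (-(l * |t|))) := by ring
          _ ≤ 1 * ‖Y0‖ + M * (1 / l) := by
              have := hexp_le t
              gcongr
          _ = _ := by ring)
  have hTapp : ∀ f t, T f t = Real.exp (-(l * |t|)) • I f t := fun f t => rfl
  have hexpint : ∀ t : ℝ, |t| * ∫ σ in (0:ℝ)..1, Real.exp (l * |t| * σ) =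
      (Real.exp (l * |t|) - 1) / l := by
    intro t
    have h := intervalIntegral.integral_eq_sub_of_hasDerivAt (a := (0:ℝ)) (b := 1)
      (f := fun σ => Real.exp (l * |t| * σ) / l) (f' := fun σ => |t| * Real.exp (l * |t| * σ)) (by
        intro σ _
        have h1 : HasDerivAt (fun σ : ℝ => l * |t| * σ) (l * |t|) σ := by
          simpa using (hasDerivAt_id σ).const_mul (l * |t|)
        have h2 := (h1.exp).div_const l
        refine h2.congr_deriv ?_
        field_simp) (by
        apply Continuous.intervalIntegrable; fun_prop)
    rw [intervalIntegral.integral_const_mul] at h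
    rw [h]; simp; ring
  have hcontr : ContractingWith (1/2) T := by
    refine ⟨by rw [← NNReal.coe_lt_coe]; norm_num, LipschitzWith.of_dist_le_mul fun f g => ?_⟩
    rw [BoundedContinuousFunction.dist_le (by positivity)]
    intro t
    rw [hTapp, hTapp, dist_eq_norm, ← smul_sub, norm_smul,
      Real.norm_of_nonneg (Real.exp_pos _).le]
    have h1 : I f t - I g t = t • ∫ σ in (0:ℝ)..1,
        (R σ (t * σ) (Yf f (t * σ)) - R σ (t * σ) (Yf g (t * σ))) := by
      rw [intervalIntegral.integral_sub ((hIntCont f t).intervalIntegrable _ _)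
        ((hIntCont g t).intervalIntegrable _ _), smul_sub]
      simp only [I]; abel
    have h2 : ‖∫ σ in (0:ℝ)..1,
        (R σ (t * σ) (Yf f (t * σ)) - R σ (t * σ) (Yf g (t * σ)))‖ ≤
        ∫ σ in (0:ℝ)..1, (L * dist f g) * Real.exp (l * |t| * σ) := by
      apply intervalIntegral.norm_integral_le_of_norm_le zero_le_one
      · refine MeasureTheory.ae_of_all _ fun σ hσ => ?_
        refine (hlip σ ⟨hσ.1.le, hσ.2⟩ _ _ _).trans ?_
        simp only [Yf]
        rw [← smul_sub, norm_smul, Real.norm_of_nonneg (Real.exp_pos _).le, ← dist_eq_norm,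
          abs_mul, abs_of_pos hσ.1, ← mul_assoc l]
        have := BoundedContinuousFunction.dist_coe_le_dist (f := f) (g := g) (t * σ)
        have h3 := Real.exp_pos (l * |t| * σ)
        calc L * (Real.exp (l * |t| * σ) * dist (f (t * σ)) (g (t * σ))) ≤
            L * (Real.exp (l * |t| * σ) * dist f g) := by gcongr
          _ = _ := by ring
      · apply Continuous.intervalIntegrable; fun_prop
    rw [intervalIntegral.integral_const_mul] at h2
    rw [h1, norm_smul, Real.norm_eq_abs]
    have h4 := Real.exp_pos (-(l * |t|))
    have h5 : Real.exp (-(l * |t|)) * Real.exp (l * |t|) = 1 := by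
      rw [← Real.exp_add]; simp
    have h6 : (0:ℝ) ≤ dist f g := dist_nonneg
    calc _ ≤ Real.exp (-(l * |t|)) * (|t| * (L * dist f g * ∫ σ in (0:ℝ)..1, Real.exp (l * |t| * σ))) := by
          gcongr
      _ = Real.exp (-(l * |t|)) * (L * dist f g * (|t| * ∫ σ in (0:ℝ)..1, Real.exp (l * |t| * σ))) := by
          ring
      _ = (1 - Real.exp (-(l * |t|))) * (dist f g / 2) := by
          rw [hexpint, hl] at *
          field_simp
          linear_combination (dist f g) * h5
      _ ≤ 1 * (dist f g / 2) := by gcongr; linarith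
      _ = _ := by simp; ring
  let f := hcontr.fixedPoint T
  have hf : T f = f := hcontr.fixedPoint_isFixedPt
  have hYI : ∀ g : ℝ →ᵇ E, T g = g → ∀ t, Yf g t = I g t := by
    intro g hg t
    have : g t = Real.exp (-(l * |t|)) • I g t := by rw [← hTapp, hg]
    simp only [Yf]
    rw [this, smul_smul, ← Real.exp_add]; simp
  have heven : ∀ t, f (-t) = f t := by
    let g : ℝ →ᵇ E := f.compContinuous ⟨fun t => -t, continuous_neg⟩
    have hga : ∀ t, g t = f (-t) := fun t => rfl
    have hYg : ∀ t, Yf g t = Yf f (-t) := by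
      intro t; simp only [Yf, hga, abs_neg]
    have hg : T g = g := by
      ext t
      rw [hga, ← hf, hTapp, hTapp, abs_neg]
      congr 1
      simp only [I, hYg]
      congr 1
      rw [neg_smul, ← smul_neg, ← intervalIntegral.integral_neg]
      congr 1
      apply intervalIntegral.integral_congr
      intro σ _
      simp only []
      rw [neg_mul, hodd, neg_neg]
    have := hcontr.fixedPoint_unique' hg hf
    intro t
    rw [← hga, this]
  refine ⟨Yf f, hYc f, fun t => ?_, fun t => hYI f hf t⟩
  simp only [Yf, heven, abs_neg]

theorem avg_continuous (n : ℕ) (g : ℝ → ℝ) (hg : Continuous g) :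
    Continuous fun t => ∫ σ in (0:ℝ)..1, σ ^ n * g (t * σ) := by
  apply intervalIntegral.continuous_parametric_intervalIntegral_of_continuous'
  unfold Function.uncurry
  fun_prop

theorem avg_hasDerivAt (n : ℕ) (g : ℝ → ℝ) (hg : ContDiff ℝ 1 g) (t : ℝ) :
    HasDerivAt (fun t => ∫ σ in (0:ℝ)..1, σ ^ n * g (t * σ))
      (∫ σ in (0:ℝ)..1, σ ^ (n + 1) * deriv g (t * σ)) t := by
  have hgc := hg.continuous
  have hg'c : Continuous (deriv g) := hg.continuous_deriv le_rfl
  have hdiff : Differentiable ℝ g := hg.differentiable (by norm_num)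
  obtain ⟨C, hC⟩ := (isCompact_Icc (a := -(|t| + 1)) (b := |t| + 1)).exists_bound_of_continuousOn
    hg'c.continuousOn
  refine (intervalIntegral.hasDerivAt_integral_of_dominated_loc_of_deriv_le
    (F' := fun t σ => σ ^ (n + 1) * deriv g (t * σ)) (bound := fun _ => C)
    (Metric.ball_mem_nhds t one_pos) ?_ ?_ ?_ ?_ ?_ ?_).2
  · exact Eventually.of_forall fun x => Continuous.aestronglyMeasurable (by fun_prop)
  · exact Continuous.intervalIntegrable (by fun_prop) _ _
  · exact Continuous.aestronglyMeasurable (by fun_prop)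
  · refine MeasureTheory.ae_of_all _ fun σ hσ x hx => ?_
    rw [uIoc_of_le zero_le_one] at hσ
    have hx1 : |x| ≤ |t| + 1 := by
      rw [Metric.mem_ball, Real.dist_eq] at hx
      have := abs_sub_abs_le_abs_sub x t
      linarith
    have h1 : |x * σ| ≤ |t| + 1 := by
      rw [abs_mul, abs_of_pos hσ.1]
      have := abs_nonneg x
      nlinarith [hσ.1, hσ.2]
    have h2 := hC (x * σ) (abs_le.1 h1)
    rw [norm_mul, norm_pow, Real.norm_of_nonneg hσ.1.le]
    have h3 : σ ^ (n + 1) ≤ 1 := pow_le_one₀ hσ.1.le hσ.2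
    have h4 : 0 ≤ σ ^ (n + 1) := pow_nonneg hσ.1.le _
    have h5 := norm_nonneg (deriv g (x * σ))
    nlinarith
  · exact Continuous.intervalIntegrable (by fun_prop) _ _
  · refine MeasureTheory.ae_of_all _ fun σ hσ x hx => ?_
    have h1 : HasDerivAt (fun x : ℝ => x * σ) σ x := by
      simpa using (hasDerivAt_id x).mul_const σ
    have h2 := ((hdiff (x * σ)).hasDerivAt.comp x h1).const_mul (σ ^ n)
    exact h2.congr_deriv (by ring)

theorem avg_contDiff (k : ℕ) : ∀ (n : ℕ) (g : ℝ → ℝ), ContDiff ℝ k g →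
    ContDiff ℝ k fun t => ∫ σ in (0:ℝ)..1, σ ^ n * g (t * σ) := by
  induction k with
  | zero =>
    intro n g hg
    simp only [Nat.cast_zero, contDiff_zero] at hg ⊢
    exact avg_continuous n g hg
  | succ k ih =>
    intro n g hg
    push_cast at hg ⊢
    have h1 : ContDiff ℝ 1 g := hg.of_le (by simp)
    rw [contDiff_succ_iff_deriv] at hg ⊢
    refine ⟨fun t => (avg_hasDerivAt n g h1 t).differentiableAt, by simp, ?_⟩
    have : deriv (fun t => ∫ σ in (0:ℝ)..1, σ ^ n * g (t * σ)) =
        fun t => ∫ σ in (0:ℝ)..1, σ ^ (n + 1) * deriv g (t * σ) :=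
      funext fun t => (avg_hasDerivAt n g h1 t).deriv
    rw [this]
    exact ih _ _ hg.2.2

theorem primitive_hasDerivAt (n : ℕ) (g : ℝ → ℝ) (hg : Continuous g) (t : ℝ) :
    HasDerivAt (fun t => t * ∫ σ in (0:ℝ)..1, σ ^ n * g (t * σ))
      (g t - n * ∫ σ in (0:ℝ)..1, σ ^ n * g (t * σ)) t := by
  set z := fun t => ∫ σ in (0:ℝ)..1, σ ^ n * g (t * σ) with hz
  have hzc : Continuous z := avg_continuous n g hg
  have key : ∀ x, x ^ (n + 1) * z x = ∫ s in (0:ℝ)..x, s ^ n * g s := by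
    intro x
    by_cases hx : x = 0
    · simp [hx]
    have h := intervalIntegral.smul_integral_comp_mul_left (a := 0) (b := 1)
      (fun s => s ^ n * g s) x
    simp only [mul_zero, mul_one, smul_eq_mul] at h
    rw [← h, hz, pow_succ]
    simp only [mul_pow, mul_assoc]
    rw [intervalIntegral.integral_const_mul]
    ring
  change HasDerivAt (fun t => t * z t) (g t - n * z t) t
  rcases eq_or_ne t 0 with rfl | ht
  · have h0 : z 0 = g 0 / (n + 1) := by
      simp [hz, integral_pow]; ring
    have h1 : g 0 - n * z 0 = z 0 := by rw [h0]; field_simp; ring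
    rw [h1, hasDerivAt_iff_tendsto_slope]
    refine Tendsto.congr' ?_ (hzc.continuousAt.mono_left nhdsWithin_le_nhds)
    filter_upwards [self_mem_nhdsWithin] with x hx
    have hx : x ≠ 0 := hx
    simp [slope_def_field]; field_simp
  · have hF : HasDerivAt (fun x => ∫ s in (0:ℝ)..x, s ^ n * g s) (t ^ n * g t) t := by
      have hc : Continuous fun s => s ^ n * g s := by fun_prop
      exact hc.integral_hasStrictDerivAt 0 t |>.hasDerivAt
    have h2 := hF.div (hasDerivAt_pow n t) (pow_ne_zero n ht)
    have h3 : HasDerivAt (fun t => t * z t) ((t ^ n * g t * t ^ n -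
        (∫ s in (0:ℝ)..t, s ^ n * g s) * (n * t ^ (n - 1))) / (t ^ n) ^ 2) t := by
      refine h2.congr_of_eventuallyEq ?_
      filter_upwards [isOpen_ne.mem_nhds ht] with x hx
      have hx : x ≠ 0 := hx
      simp only [Pi.div_apply]
      rw [← key, pow_succ]; field_simp
    convert h3 using 1
    rw [← key]
    rcases n with _ | n
    · simp
    · simp only [Nat.add_sub_cancel]
      field_simp
      ring

/-- Bootstrap: solutions of the integral system are smooth. -/
theorem bootstrap (n : ℕ) (P Q : ℝ × ℝ × ℝ → ℝ)
    (hP : ContDiff ℝ (⊤ : ℕ∞) P) (hQ : ContDiff ℝ (⊤ : ℕ∞) Q) (y s : ℝ → ℝ) (s0 : ℝ)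
    (hyc : Continuous y) (hsc : Continuous s)
    (hy : ∀ t, y t = t * ∫ σ in (0:ℝ)..1, σ ^ n * P (t * σ, y (t * σ), s (t * σ)))
    (hs : ∀ t, s t = s0 + t * ∫ σ in (0:ℝ)..1, Q (t * σ, y (t * σ), s (t * σ))) :
    ContDiff ℝ (⊤ : ℕ∞) y ∧ ContDiff ℝ (⊤ : ℕ∞) s ∧
    (∀ t, t * deriv y t = t * P (t, y t, s t) - n * y t) ∧
    (∀ t, deriv s t = Q (t, y t, s t)) := by
  set g := fun t => P (t, y t, s t) with hg
  set h := fun t => Q (t, y t, s t) with hh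
  have hgc : Continuous g := hP.continuous.comp (by fun_prop)
  have hhc : Continuous h := hQ.continuous.comp (by fun_prop)
  have hy' : y = fun t => t * ∫ σ in (0:ℝ)..1, σ ^ n * g (t * σ) := funext hy
  have hs' : s = fun t => s0 + t * ∫ σ in (0:ℝ)..1, σ ^ 0 * h (t * σ) := by
    funext t; rw [hs]; simp [hh]
  have dy : ∀ t, HasDerivAt y (g t - n * ∫ σ in (0:ℝ)..1, σ ^ n * g (t * σ)) t := by
    intro t
    have := primitive_hasDerivAt n g hgc t
    rw [hy']
    rw [← hy'] 
    rwa [← hy'] at this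
  have ds : ∀ t, HasDerivAt s (h t) t := by
    intro t
    have := (primitive_hasDerivAt 0 h hhc t).const_add s0
    rw [← hs'] at this
    simpa using this
  have main : ∀ k : ℕ, ContDiff ℝ k y ∧ ContDiff ℝ k s := by
    intro k
    induction k with
    | zero => simp [contDiff_zero, hyc, hsc]
    | succ k ih =>
      have hPk : ContDiff ℝ k P := hP.of_le (by exact_mod_cast le_top)
      have hQk : ContDiff ℝ k Q := hQ.of_le (by exact_mod_cast le_top)
      have h3 : ContDiff ℝ k fun t => (t, y t, s t) := contDiff_id.prodMk (ih.1.prodMk ih.2)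
      have hgk : ContDiff ℝ k g := hPk.comp h3
      have hhk : ContDiff ℝ k h := hQk.comp h3
      push_cast
      rw [contDiff_succ_iff_deriv, contDiff_succ_iff_deriv]
      refine ⟨⟨fun t => (dy t).differentiableAt, by simp, ?_⟩,
        ⟨fun t => (ds t).differentiableAt, by simp, ?_⟩⟩
      · rw [funext fun t => (dy t).deriv]
        exact hgk.sub (contDiff_const.mul (avg_contDiff k n g hgk))
      · rw [funext fun t => (ds t).deriv]
        exact hhk
  refine ⟨contDiff_infty.2 fun k => (main k).1, contDiff_infty.2 fun k => (main k).2,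
    fun t => ?_, fun t => (ds t).deriv⟩
  rw [(dy t).deriv]
  have := hy t
  change y t = t * ∫ σ in (0:ℝ)..1, σ ^ n * g (t * σ) at this
  linear_combination (n:ℝ) * this

theorem exists_cutoff_inv (D : ℝ × ℝ × ℝ → ℝ) (hD : ContDiff ℝ (⊤ : ℕ∞) D)
    (K : Set (ℝ × ℝ × ℝ)) (hK : IsCompact K) (hKD : ∀ q ∈ K, 0 < D q) :
    ∃ k : ℝ × ℝ × ℝ → ℝ, ContDiff ℝ (⊤ : ℕ∞) k ∧ HasCompactSupport k ∧ (∀ q, 0 ≤ k q) ∧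
      (∀ q, k q * D q ≤ 1) ∧ ∀ q ∈ K, k q * D q = 1 := by
  obtain ⟨ρ, hρ⟩ := hK.isBounded.subset_ball (0 : ℝ × ℝ × ℝ)
  set O : Set (ℝ × ℝ × ℝ) := {q | 0 < D q} ∩ Metric.ball 0 ρ with hO
  have hOo : IsOpen O := (isOpen_lt continuous_const hD.continuous).inter Metric.isOpen_ball
  have hKO : K ⊆ O := fun q hq => ⟨hKD q hq, hρ hq⟩
  obtain ⟨f, hf0, hf1, hf⟩ := exists_contMDiffMap_zero_one_nhds_of_isClosed
    (modelWithCornersSelf ℝ (ℝ × ℝ × ℝ)) (n := (⊤ : ℕ∞)) hOo.isClosed_compl hK.isClosed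
    (disjoint_left.2 fun q h1 h2 => h1 (hKO h2))
  have hfs : ContDiff ℝ (⊤ : ℕ∞) f := f.contMDiff.contDiff
  have hloc : ∀ q ∉ O, ∀ᶠ x in 𝓝 q, f x = 0 := by
    intro q hq
    exact eventually_nhdsSet_iff_forall.1 hf0 q hq
  have hz : ∀ q, q ∉ O → f q = 0 := fun q hq => (hloc q hq).self_of_nhds
  have hmul : ∀ q, f q / D q * D q = f q := by
    intro q
    by_cases hq : q ∈ O
    · have : D q ≠ 0 := (hq.1 : 0 < D q).ne'
      field_simp
    · simp [hz q hq]
  refine ⟨fun q => f q / D q, ?_, ?_, ?_, ?_, ?_⟩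
  · rw [contDiff_iff_contDiffAt]
    intro q
    by_cases hq : q ∈ O
    · exact hfs.contDiffAt.div hD.contDiffAt (hq.1 : 0 < D q).ne'
    · have : (fun q => f q / D q) =ᶠ[𝓝 q] fun _ => 0 := by
        filter_upwards [hloc q hq] with x hx
        simp [hx]
      exact contDiffAt_const.congr_of_eventuallyEq this
  · refine HasCompactSupport.intro (isCompact_closedBall (0 : ℝ × ℝ × ℝ) ρ) fun q hq => ?_
    have : q ∉ O := fun h => hq (Metric.ball_subset_closedBall h.2)
    simp [hz q this]
  · intro q
    by_cases hq : q ∈ O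
    · exact div_nonneg (hf q).1 (hq.1 : 0 < D q).le
    · simp [hz q hq]
  · intro q
    simp only [hmul]
    exact (hf q).2
  · intro q hq
    simp only [hmul]
    exact (eventually_nhdsSet_iff_forall.1 hf1 q hq).self_of_nhds

theorem cutoff_solution (d : ℕ) (w0 : ℝ) (F G : ℝ × ℝ × ℝ → ℝ)
    (hF : ContDiff ℝ (⊤ : ℕ∞) F) (hG : ContDiff ℝ (⊤ : ℕ∞) G)
    (hFs : HasCompactSupport F) (hGs : HasCompactSupport G) :
    ∃ w s : ℝ → ℝ, ContDiff ℝ (⊤ : ℕ∞) w ∧ ContDiff ℝ (⊤ : ℕ∞) s ∧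
      (∀ t, w (-t) = w t) ∧ (∀ t, s (-t) = s t) ∧ w 0 = w0 ∧ s 0 = 1 ∧
      (∀ t, t * deriv w t = t ^ 2 * (1 / (1 + t ^ 2)) * F (1 / (1 + t ^ 2), w t, s t)
        - d * (w t - w0)) ∧
      (∀ t, deriv s t = t * (1 / (1 + t ^ 2)) * G (1 / (1 + t ^ 2), w t, s t)) := by
  obtain ⟨L1, hL1⟩ := ContDiff.lipschitzWith_of_hasCompactSupport hFs hF (by simp)
  obtain ⟨L2, hL2⟩ := ContDiff.lipschitzWith_of_hasCompactSupport hGs hG (by simp)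
  obtain ⟨M1, hM1⟩ := hF.continuous.bounded_above_of_compact_support hFs
  obtain ⟨M2, hM2⟩ := hG.continuous.bounded_above_of_compact_support hGs
  set h : ℝ → ℝ := fun t => 1 / (1 + t ^ 2) with hh
  have hhs : ContDiff ℝ (⊤ : ℕ∞) h :=
    contDiff_const.div (by fun_prop) (fun t => by positivity)
  have hhc := hhs.continuous
  have hth : ∀ t, |t * h t| ≤ 1 := by
    intro t
    rw [abs_le]
    have : 0 < 1 + t ^ 2 := by positivity
    constructor
    · simp only [hh]; rw [mul_one_div, le_div_iff₀ this]; nlinarith [sq_nonneg (t + 1)]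
    · simp only [hh]; rw [mul_one_div, div_le_iff₀ this]; nlinarith [sq_nonneg (t - 1)]
  set P : ℝ × ℝ × ℝ → ℝ := fun q => q.1 * h q.1 * F (h q.1, w0 + q.2.1, q.2.2) with hP
  set Q : ℝ × ℝ × ℝ → ℝ := fun q => q.1 * h q.1 * G (h q.1, w0 + q.2.1, q.2.2) with hQ
  have hmap : ContDiff ℝ (⊤ : ℕ∞) fun q : ℝ × ℝ × ℝ => (h q.1, w0 + q.2.1, q.2.2) :=
    (hhs.comp contDiff_fst).prodMk (by fun_prop)
  have hPs : ContDiff ℝ (⊤ : ℕ∞) P :=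
    (contDiff_fst.mul (hhs.comp contDiff_fst)).mul (hF.comp hmap)
  have hQs : ContDiff ℝ (⊤ : ℕ∞) Q :=
    (contDiff_fst.mul (hhs.comp contDiff_fst)).mul (hG.comp hmap)
  have hPc := hPs.continuous
  have hQc := hQs.continuous
  have hlipgen : ∀ (A : ℝ × ℝ × ℝ → ℝ) (N : NNReal), LipschitzWith N A → ∀ t (Y Z : ℝ × ℝ),
      |t * h t * A (h t, w0 + Y.1, Y.2) - t * h t * A (h t, w0 + Z.1, Z.2)| ≤ N * ‖Y - Z‖ := by
    intro A N hA t Y Z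
    rw [← mul_sub, abs_mul]
    have h1 := hA.dist_le_mul (h t, w0 + Y.1, Y.2) (h t, w0 + Z.1, Z.2)
    have h2 : dist (h t, w0 + Y.1, Y.2) (h t, w0 + Z.1, Z.2) = ‖Y - Z‖ := by
      rw [Prod.dist_eq, Prod.dist_eq, Prod.norm_def]
      simp [Real.dist_eq]
    rw [h2, Real.dist_eq] at h1
    have h3 := hth t
    calc _ ≤ 1 * (N * ‖Y - Z‖) := by gcongr
      _ = _ := one_mul _
  obtain ⟨Y, hYc, hYe, hY⟩ := volterra_exists (E := ℝ × ℝ)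
    (fun σ t Y => (σ ^ d * P (t, Y), Q (t, Y)))
    (by fun_prop) (L1 + L2 + 1) (|M1| + |M2|) (by positivity) (by positivity)
    (by
      intro σ hσ t Y Z
      have h1 := hlipgen F L1 hL1 t Y Z
      have h2 := hlipgen G L2 hL2 t Y Z
      have h3 : |σ ^ d| ≤ 1 := by
        rw [abs_of_nonneg (pow_nonneg hσ.1 _)]; exact pow_le_one₀ hσ.1 hσ.2
      have h4 := norm_nonneg (Y - Z)
      have h5 := L1.2
      have h6 := L2.2
      rw [Prod.norm_def]
      apply max_le
      · simp only [Prod.fst_sub, ← mul_sub, Real.norm_eq_abs, abs_mul (σ ^ d)]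
        calc _ ≤ 1 * (L1 * ‖Y - Z‖) := by gcongr
          _ ≤ _ := by rw [one_mul]; gcongr; linarith [L2.coe_nonneg]
      · simp only [Prod.snd_sub, Real.norm_eq_abs]
        calc _ ≤ (L2 * ‖Y - Z‖) := h2
          _ ≤ _ := by gcongr; linarith [L1.coe_nonneg])
    (by
      intro σ hσ t Y
      have h1 := hM1 (h t, w0 + Y.1, Y.2)
      have h2 := hM2 (h t, w0 + Y.1, Y.2)
      have h3 : |σ ^ d| ≤ 1 := by
        rw [abs_of_nonneg (pow_nonneg hσ.1 _)]; exact pow_le_one₀ hσ.1 hσ.2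
      have h4 := hth t
      rw [Real.norm_eq_abs] at h1 h2
      rw [Prod.norm_def]
      apply max_le
      · simp only [hP, Real.norm_eq_abs]
        rw [abs_mul, abs_mul (t * h t)]
        calc _ ≤ 1 * (1 * M1) := by gcongr
          _ ≤ _ := by linarith [le_abs_self M1, abs_nonneg M2]
      · simp only [hQ, Real.norm_eq_abs]
        rw [abs_mul (t * h t)]
        calc _ ≤ (1 * M2) := by gcongr
          _ ≤ _ := by linarith [le_abs_self M2, abs_nonneg M1])
    (by
      intro σ t Y
      simp only [hP, hQ, hh, even_two, Even.neg_pow, Prod.neg_mk]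
      congr 1 <;> ring)
    (0, 1)
  have hint1 : ∀ t, Continuous fun σ => (σ ^ d * P (t * σ, Y (t * σ)), Q (t * σ, Y (t * σ))) := by
    intro t; fun_prop
  have hfst : ∀ t, (∫ σ in (0:ℝ)..1, (σ ^ d * P (t * σ, Y (t * σ)), Q (t * σ, Y (t * σ)))).1 =
      ∫ σ in (0:ℝ)..1, σ ^ d * P (t * σ, Y (t * σ)) := by
    intro t
    have := ((ContinuousLinearMap.fst ℝ ℝ ℝ).intervalIntegral_comp_comm
      ((hint1 t).intervalIntegrable (μ := MeasureTheory.volume) 0 1))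
    simpa using this.symm
  have hsnd : ∀ t, (∫ σ in (0:ℝ)..1, (σ ^ d * P (t * σ, Y (t * σ)), Q (t * σ, Y (t * σ)))).2 =
      ∫ σ in (0:ℝ)..1, Q (t * σ, Y (t * σ)) := by
    intro t
    have := ((ContinuousLinearMap.snd ℝ ℝ ℝ).intervalIntegral_comp_comm
      ((hint1 t).intervalIntegrable (μ := MeasureTheory.volume) 0 1))
    simpa using this.symm
  have hy : ∀ t, (Y t).1 = t * ∫ σ in (0:ℝ)..1, σ ^ d * P (t * σ, Y (t * σ)) := by
    intro t
    rw [← hfst]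
    have := congrArg Prod.fst (hY t)
    simpa using this
  have hs : ∀ t, (Y t).2 = 1 + t * ∫ σ in (0:ℝ)..1, Q (t * σ, Y (t * σ)) := by
    intro t
    rw [← hsnd]
    have := congrArg Prod.snd (hY t)
    simpa using this
  obtain ⟨b1, b2, b3, b4⟩ := bootstrap d P Q hPs hQs (fun t => (Y t).1) (fun t => (Y t).2) 1
    (by fun_prop) (by fun_prop) hy hs
  refine ⟨fun t => w0 + (Y t).1, fun t => (Y t).2, contDiff_const.add b1, b2,
    fun t => by simp only [hYe], fun t => by simp only [hYe], ?_, ?_, ?_, ?_⟩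
  · simp only []; rw [hy]; simp
  · simp only []; rw [hs]; simp
  · intro t
    have := b3 t
    simp only [deriv_const_add, hP] at this ⊢
    rw [this]; simp only [hh]; ring
  · intro t
    exact b4 t

theorem comparison (d : ℕ) (hd : 1 ≤ d) (v q : ℝ → ℝ) (hv : Differentiable ℝ v)
    (hq : Continuous q)
    (h : ∀ t, 0 < t → 0 ≤ t * deriv v t + (d - t * q t) * v t) : ∀ t, 0 < t → 0 ≤ v t := by
  set I : ℝ → ℝ := fun t => ∫ x in (0:ℝ)..t, q x with hI
  have hId : ∀ t, HasDerivAt I (q t) t := fun t => (hq.integral_hasStrictDerivAt 0 t).hasDerivAt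
  have hΦ : ∀ t, HasDerivAt (fun t => t ^ d * Real.exp (-I t) * v t)
      ((d * t ^ (d - 1) * Real.exp (-I t) + t ^ d * (Real.exp (-I t) * (-q t))) * v t +
        t ^ d * Real.exp (-I t) * deriv v t) t := by
    intro t
    exact ((hasDerivAt_pow d t).mul ((hId t).neg.exp)).mul (hv t).hasDerivAt
  have hmono : MonotoneOn (fun t => t ^ d * Real.exp (-I t) * v t) (Ici 0) := by
    apply monotoneOn_of_deriv_nonneg (convex_Ici 0)
    · exact fun t _ => (hΦ t).continuousAt.continuousWithinAt
    · exact fun t _ => (hΦ t).differentiableAt.differentiableWithinAt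
    · intro t ht
      rw [interior_Ici] at ht
      have ht : 0 < t := ht
      rw [(hΦ t).deriv]
      have h1 := h t ht
      obtain ⟨n, rfl⟩ : ∃ n, d = n + 1 := ⟨d - 1, by omega⟩
      simp only [Nat.add_sub_cancel, pow_succ]
      have h2 : 0 ≤ t ^ n * Real.exp (-I t) := by positivity
      have h3 := mul_nonneg h2 h1
      push_cast at h3 ⊢
      linarith
  intro t ht
  have h1 := hmono (mem_Ici.2 le_rfl) (mem_Ici.2 ht.le) ht.le
  simp only [zero_pow (by omega : d ≠ 0), zero_mul] at h1
  have h2 : 0 < t ^ d * Real.exp (-I t) := by positivity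
  exact nonneg_of_mul_nonneg_right h1 h2

theorem linear_pos (s q : ℝ → ℝ) (hs : Differentiable ℝ s) (hq : Continuous q) (h0 : s 0 = 1)
    (h : ∀ t, deriv s t = q t * s t) : ∀ t, 0 < s t := by
  set I : ℝ → ℝ := fun t => ∫ x in (0:ℝ)..t, q x with hI
  have hId : ∀ t, HasDerivAt I (q t) t := fun t => (hq.integral_hasStrictDerivAt 0 t).hasDerivAt
  have hΦ : ∀ t, HasDerivAt (fun t => Real.exp (-I t) * s t) 0 t := by
    intro t
    refine (((hId t).neg.exp).mul (hs t).hasDerivAt).congr_deriv ?_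
    rw [h t]; ring
  intro t
  have h1 := is_const_of_deriv_eq_zero (fun t => (hΦ t).differentiableAt) (fun t => (hΦ t).deriv)
    t 0
  simp only [h0, mul_one] at h1
  have h2 : 0 < Real.exp (-I t) * s t := by rw [h1]; positivity
  exact pos_of_mul_pos_right h2 (Real.exp_pos _).le

theorem profile_exists (d : ℕ) (hd : 1 ≤ d) (α m : ℝ) (hα : 0 < α) (hm : 0 < m)
    (hmd : m < α * d) (w0 : ℝ) (hw0 : w0 = -m / (α * d)) :
    ∃ w s : ℝ → ℝ, ContDiff ℝ (⊤ : ℕ∞) w ∧ ContDiff ℝ (⊤ : ℕ∞) s ∧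
      (∀ t, w (-t) = w t) ∧ (∀ t, s (-t) = s t) ∧ w 0 = w0 ∧ s 0 = 1 ∧ (∀ t, 0 < s t) ∧
      ∀ t, 0 < t → w0 ≤ w t ∧ w t ≤ 0 ∧ s t ≤ 1 ∧
        (t ^ 2 * (1 + w t) ^ 2 + α ^ 2 * s t ^ 2) * (t * deriv w t) =
          - t ^ 2 * (1 + w t) * w t * (m + 1 + w t) - d * (w t - w0) * α ^ 2 * s t ^ 2 ∧
        (t ^ 2 * (1 + w t) ^ 2 + α ^ 2 * s t ^ 2) * deriv s t =
          t * s t * (α * m * w t - (1 + w t) * (m + α * (d - 1) * w t)) := by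
  have hd1 : (1:ℝ) ≤ d := by exact_mod_cast hd
  have hαd : 0 < α * d := by positivity
  have hw0d : α * d * w0 = -m := by rw [hw0]; field_simp
  have hw0neg : w0 < 0 := by
    by_contra hcon; push Not at hcon
    have := mul_nonneg hαd.le hcon; linarith
  have hκ : 0 < 1 + w0 := by
    by_contra hcon
    have h1 : α * d * (1 + w0) ≤ 0 := mul_nonpos_of_nonneg_of_nonpos hαd.le (by linarith)
    nlinarith
  set κ := 1 + w0 with hκdef
  set Kc := m * (1 + α) with hKc
  have hKcpos : 0 < Kc := by positivity
  set β := α ^ 2 / Kc with hβ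
  have hβpos : 0 < β := by positivity
  have hβK : β * Kc = α ^ 2 := by rw [hβ]; field_simp
  set c1 := min (κ ^ 2) Kc with hc1
  have hc1pos : 0 < c1 := lt_min (by positivity) hKcpos
  set c2 := min 1 β / 2 with hc2
  have hc2pos : 0 < c2 := by have : 0 < min 1 β := lt_min one_pos hβpos
                             positivity
  set D : ℝ × ℝ × ℝ → ℝ := fun q => (1 - q.1) * (1 + q.2.1) ^ 2 + q.1 * α ^ 2 * q.2.2 ^ 2 with hD
  have hDs : ContDiff ℝ (⊤ : ℕ∞) D := by simp only [hD]; fun_prop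
  set K : Set (ℝ × ℝ × ℝ) := (Icc 0 1 ×ˢ (Icc (-1) 0 ×ˢ Icc 0 1)) ∩ {q | c1 * c2 ≤ D q} with hK
  have hKc : IsCompact K := (isCompact_Icc.prod (isCompact_Icc.prod isCompact_Icc)).inter_right
    (isClosed_le continuous_const hDs.continuous)
  obtain ⟨k, hks, hkc, hk0, hk1, hkK⟩ := exists_cutoff_inv D hDs K hKc (by
    intro q hq
    have : c1 * c2 ≤ D q := hq.2
    have h2 : 0 < c1 * c2 := by positivity
    linarith)
  obtain ⟨w, s, hws, hss, hwe, hse, hw00, hs00, hwd, hsd⟩ := cutoff_solution d w0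
    (fun q => k q * (d * (q.2.1 - w0) * (1 + q.2.1) ^ 2 -
      (1 + q.2.1) * q.2.1 * (m + 1 + q.2.1)))
    (fun q => k q * (q.2.2 * (α * m * q.2.1 - (1 + q.2.1) * (m + α * (d - 1) * q.2.1))))
    (hks.mul (by fun_prop)) (hks.mul (by fun_prop)) hkc.mul_right hkc.mul_right
  simp only [] at hwd hsd
  set h : ℝ → ℝ := fun t => 1 / (1 + t ^ 2) with hh
  have hhc : Continuous h := continuous_const.div (by fun_prop) (fun t => by positivity)
  have hhpos : ∀ t, 0 < h t := fun t => by simp only [hh]; positivity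
  have hhe : ∀ t, h t * (1 + t ^ 2) = 1 := fun t => by simp only [hh]; field_simp
  have hwc := hws.continuous
  have hsc := hss.continuous
  have hwdiff : Differentiable ℝ w := hws.differentiable (by simp)
  have hsdiff : Differentiable ℝ s := hss.differentiable (by simp)
  set ρ : ℝ → ℝ := fun t => k (h t, w t, s t) with hρ
  have hρc : Continuous ρ := hks.continuous.comp (by fun_prop)
  have hρ0 : ∀ t, 0 ≤ ρ t := fun t => hk0 _
  have hρD : ∀ t, h t * ρ t * (t ^ 2 * (1 + w t) ^ 2 + α ^ 2 * s t ^ 2) = ρ t * D (h t, w t, s t) := by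
    intro t
    simp only [hD]
    linear_combination ((1 + w t) ^ 2 * ρ t) * hhe t
  have hρ1 : ∀ t, h t * ρ t * (t ^ 2 * (1 + w t) ^ 2 + α ^ 2 * s t ^ 2) ≤ 1 := by
    intro t; rw [hρD]; exact hk1 _
  have hwd' : ∀ t, t * deriv w t = t ^ 2 * h t * (ρ t * (d * (w t - w0) * (1 + w t) ^ 2 -
      (1 + w t) * w t * (m + 1 + w t))) - d * (w t - w0) := hwd
  have hsd' : ∀ t, deriv s t = t * h t * (ρ t * (s t * (α * m * w t -
      (1 + w t) * (m + α * (d - 1) * w t)))) := hsd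
  have hspos : ∀ t, 0 < s t := by
    apply linear_pos s (fun t => t * h t * (ρ t * (α * m * w t -
      (1 + w t) * (m + α * (d - 1) * w t)))) hsdiff (by fun_prop) hs00
    intro t; rw [hsd']; ring
  have hwlow : ∀ t, 0 < t → 0 ≤ w t - w0 := by
    apply comparison d hd (fun t => w t - w0) (fun t => t * h t * ρ t * (d * (1 + w t) ^ 2 -
      (w t ^ 2 + w t * w0 + w0 ^ 2 + (m + 2) * (w t + w0) + (m + 1)))) (by fun_prop) (by fun_prop)
    intro t ht
    simp only [deriv_sub_const]
    rw [mul_sub] at *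
    have h1 : 0 ≤ t ^ 2 * h t * ρ t * (-((1 + w0) * w0 * (m + 1 + w0))) := by
      have h2 : 0 ≤ (1 + w0) * (-w0) * (m + 1 + w0) := by
        apply mul_nonneg (mul_nonneg hκ.le (by linarith)); linarith
      have h3 := hhpos t
      have h4 := hρ0 t
      apply mul_nonneg (by positivity); linarith
    have h5 := hwd' t
    have h6 : t * deriv w t + (d - t * (t * h t * ρ t * (d * (1 + w t) ^ 2) - t * h t * ρ t *
      (w t ^ 2 + w t * w0 + w0 ^ 2 + (m + 2) * (w t + w0) + (m + 1)))) * (w t - w0) =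
      t ^ 2 * h t * ρ t * (-((1 + w0) * w0 * (m + 1 + w0))) := by
      rw [h5]; ring
    linarith
  have hwup : ∀ t, 0 < t → 0 ≤ - w t := by
    apply comparison d hd (fun t => - w t) (fun t => d * (t * h t * ρ t * (1 + w t) ^ 2) -
      t * h t * ρ t * (1 + w t) * (m + 1 + w t)) (by fun_prop) (by fun_prop)
    intro t ht
    rw [deriv.fun_neg]
    have h1 : 0 ≤ 1 - t ^ 2 * h t * ρ t * (1 + w t) ^ 2 := by
      have h2 := hρ1 t
      have h3 : 0 ≤ h t * ρ t * (α ^ 2 * s t ^ 2) := by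
        have h3 := hhpos t
        have h4 := hρ0 t
        positivity
      nlinarith
    have h5 := hwd' t
    have h6 : t * -deriv w t + (d - t * (d * (t * h t * ρ t * (1 + w t) ^ 2) -
      t * h t * ρ t * (1 + w t) * (m + 1 + w t))) * -w t =
      d * (-w0) * (1 - t ^ 2 * h t * ρ t * (1 + w t) ^ 2) := by
      linear_combination -h5
    rw [h6]
    apply mul_nonneg (mul_nonneg (by positivity) (by linarith)) h1
  -- bounds on the bracket
  have hmd' : ∀ t, 0 < t → 0 ≤ m + α * (d - 1) * w t := by
    intro t ht
    have h1 := hwlow t ht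
    have h2 : 0 ≤ α * (d - 1) * (w t - w0) :=
      mul_nonneg (mul_nonneg hα.le (by linarith)) h1
    have h3 : 0 ≤ α * (-w0) := mul_nonneg hα.le (by linarith)
    linarith
  have hB0 : ∀ t, 0 < t → α * m * w t - (1 + w t) * (m + α * (d - 1) * w t) ≤ 0 := by
    intro t ht
    have h1 := hwlow t ht
    have h2 := hwup t ht
    have h3 := hmd' t ht
    have h4 : 0 ≤ (1 + w t) * (m + α * (d - 1) * w t) := mul_nonneg (by linarith) h3
    have h5 : 0 ≤ α * m * (- w t) := mul_nonneg (by positivity) h2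
    linarith
  have hB1 : ∀ t, 0 < t → -(m * (1 + α)) ≤ α * m * w t - (1 + w t) * (m + α * (d - 1) * w t) := by
    intro t ht
    have h1 := hwlow t ht
    have h2 := hwup t ht
    have h3 := hmd' t ht
    have h4 : 0 ≤ α * m * (1 + w t) := mul_nonneg (by positivity) (by linarith)
    have h5 : 0 ≤ (-w t) * (m + α * (d - 1) * w t) := mul_nonneg h2 h3
    have h6 : 0 ≤ α * (d - 1) * (-w t) := mul_nonneg (mul_nonneg hα.le (by linarith)) h2
    linarith
  have hs1 : ∀ t, 0 < t → s t ≤ 1 := by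
    have hanti : AntitoneOn s (Ici 0) := by
      apply antitoneOn_of_deriv_nonpos (convex_Ici 0) hsc.continuousOn hsdiff.differentiableOn
      intro t ht
      rw [interior_Ici] at ht
      have ht : 0 < t := ht
      rw [hsd']
      have h1 := hB0 t ht
      have h2 : 0 ≤ t * h t * (ρ t * s t) := by
        have := hhpos t
        have := hρ0 t
        have := hspos t
        positivity
      have := mul_nonpos_of_nonneg_of_nonpos h2 h1
      linarith
    intro t ht
    have := hanti (mem_Ici.2 le_rfl) (mem_Ici.2 ht.le) ht.le
    rwa [hs00] at this
  have hE : ∀ t, 0 < t → β ≤ t ^ 2 + β * s t ^ 2 := by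
    have hder : ∀ t, HasDerivAt (fun t => t ^ 2 + β * s t ^ 2)
        (2 * t + β * (2 * s t * deriv s t)) t := by
      intro t
      have h1 := (hsdiff t).hasDerivAt
      refine ((hasDerivAt_pow 2 t).add ((h1.pow 2).const_mul β)).congr_deriv ?_
      simp
    have hmono : MonotoneOn (fun t => t ^ 2 + β * s t ^ 2) (Ici 0) := by
      apply monotoneOn_of_deriv_nonneg (convex_Ici 0)
      · exact fun t _ => (hder t).continuousAt.continuousWithinAt
      · exact fun t _ => (hder t).differentiableAt.differentiableWithinAt
      intro t ht
      rw [interior_Ici] at ht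
      have ht : 0 < t := ht
      rw [(hder t).deriv, hsd']
      have h1 := hB1 t ht
      have hp := hhpos t
      have h4 := hρ0 t
      have h3 : h t * ρ t * (α ^ 2 * s t ^ 2) ≤ 1 := by
        have h2 := hρ1 t
        have : 0 ≤ h t * ρ t * (t ^ 2 * (1 + w t) ^ 2) := by positivity
        linarith
      have h5 : 0 ≤ 2 * t * β * (h t * ρ t * s t ^ 2) := by positivity
      have h6 := mul_le_mul_of_nonneg_left h1 h5
      have h7 : 2 * t * β * (h t * ρ t * s t ^ 2) * (m * (1 + α)) =
        2 * t * (h t * ρ t * (α ^ 2 * s t ^ 2)) := by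
        rw [← hβK]; ring
      have h8 : 2 * t * (h t * ρ t * (α ^ 2 * s t ^ 2)) ≤ 2 * t * 1 := by gcongr
      linarith
    intro t ht
    have := hmono (mem_Ici.2 le_rfl) (mem_Ici.2 ht.le) ht.le
    simpa [hs00] using this
  have hDlow : ∀ t, 0 < t → c1 * c2 ≤ D (h t, w t, s t) := by
    intro t ht
    have h1 : c1 * (t ^ 2 + β * s t ^ 2) ≤ t ^ 2 * (1 + w t) ^ 2 + α ^ 2 * s t ^ 2 := by
      have h2 : c1 ≤ (1 + w t) ^ 2 := by
        refine (min_le_left _ _).trans ?_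
        have := hwlow t ht
        apply pow_le_pow_left₀ hκ.le; linarith
      have h3 : c1 ≤ Kc := min_le_right _ _
      have h4 := mul_le_mul_of_nonneg_left h2 (sq_nonneg t)
      have h5 := mul_le_mul_of_nonneg_left h3 (by positivity : 0 ≤ β * s t ^ 2)
      have h6 : β * s t ^ 2 * Kc = α ^ 2 * s t ^ 2 := by rw [← hβK]; ring
      linarith
    have h2 : c2 * (1 + t ^ 2) ≤ t ^ 2 + β * s t ^ 2 := by
      have h3 := hE t ht
      have h4 : min 1 β ≤ 1 := min_le_left _ _
      have h5 : min 1 β ≤ β := min_le_right _ _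
      have h6 : 0 ≤ β * s t ^ 2 := by positivity
      have h7 := mul_le_mul_of_nonneg_right h4 (sq_nonneg t)
      simp only [hc2]
      linarith
    have h3 : D (h t, w t, s t) = h t * (t ^ 2 * (1 + w t) ^ 2 + α ^ 2 * s t ^ 2) := by
      simp only [hD]
      linear_combination (-(1 + w t) ^ 2) * hhe t
    rw [h3]
    have h4 : c1 * (c2 * (1 + t ^ 2)) ≤ t ^ 2 * (1 + w t) ^ 2 + α ^ 2 * s t ^ 2 :=
      (mul_le_mul_of_nonneg_left h2 hc1pos.le).trans h1
    have h5 := mul_le_mul_of_nonneg_left h4 (hhpos t).le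
    have h6 : h t * (c1 * (c2 * (1 + t ^ 2))) = c1 * c2 := by
      linear_combination c1 * c2 * hhe t
    linarith
  have hone : ∀ t, 0 < t → h t * ρ t * (t ^ 2 * (1 + w t) ^ 2 + α ^ 2 * s t ^ 2) = 1 := by
    intro t ht
    rw [hρD]
    apply hkK
    have h1 := hwlow t ht
    have h2 := hwup t ht
    have h3 := hspos t
    have h4 := hs1 t ht
    have h5 := hhpos t
    have h6 := hhe t
    refine ⟨⟨⟨h5.le, ?_⟩, ⟨?_, ?_⟩, ⟨h3.le, h4⟩⟩, hDlow t ht⟩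
    · change h t ≤ 1
      nlinarith [mul_nonneg h5.le (sq_nonneg t)]
    · change -1 ≤ w t
      linarith
    · change w t ≤ 0
      linarith
  refine ⟨w, s, hws, hss, hwe, hse, hw00, hs00, hspos, fun t ht => ⟨?_, ?_, hs1 t ht, ?_, ?_⟩⟩
  · linarith [hwlow t ht]
  · linarith [hwup t ht]
  · rw [hwd']
    linear_combination (t ^ 2 * (d * (w t - w0) * (1 + w t) ^ 2 -
      (1 + w t) * w t * (m + 1 + w t))) * hone t ht
  · rw [hsd']
    linear_combination (t * (s t * (α * m * w t -
      (1 + w t) * (m + α * (d - 1) * w t)))) * hone t ht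

theorem profile_decay (d : ℕ) (hd : 1 ≤ d) (α m : ℝ) (hα : 0 < α) (hm : 0 < m)
    (w0 : ℝ) (hw0d : α * d * w0 = -m) (hκ : 0 < 1 + w0)
    (w s : ℝ → ℝ) (hw : Differentiable ℝ w) (hs : Differentiable ℝ s) (hspos : ∀ t, 0 < s t)
    (H : ∀ t, 0 < t → w0 ≤ w t ∧ w t ≤ 0 ∧ s t ≤ 1 ∧
        (t ^ 2 * (1 + w t) ^ 2 + α ^ 2 * s t ^ 2) * (t * deriv w t) =
          - t ^ 2 * (1 + w t) * w t * (m + 1 + w t) - d * (w t - w0) * α ^ 2 * s t ^ 2 ∧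
        (t ^ 2 * (1 + w t) ^ 2 + α ^ 2 * s t ^ 2) * deriv s t =
          t * s t * (α * m * w t - (1 + w t) * (m + α * (d - 1) * w t))) :
    ∃ C : ℝ, 0 < C ∧ ∀ t, 1 ≤ t → |t * w t| + |s t| ≤ C * t ^ (-m) := by
  have hd1 : (1:ℝ) ≤ d := by exact_mod_cast hd
  set κ := 1 + w0 with hκdef
  set V : ℝ → ℝ := fun t => -(t * w t) with hV
  set V' : ℝ → ℝ := fun t => -(w t + t * deriv w t) with hV'
  have hVd : ∀ t, HasDerivAt V (V' t) t := by
    intro t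
    refine (((hasDerivAt_id t).mul (hw t).hasDerivAt).neg).congr_deriv ?_
    simp [hV']
  have hV0 : ∀ t, 0 < t → 0 ≤ V t := by
    intro t ht
    have := mul_nonneg ht.le (neg_nonneg.2 (H t ht).2.1)
    simp only [hV]; linarith
  set E : ℝ → ℝ := fun t => t ^ 2 * (1 + w t) ^ 2 + α ^ 2 * s t ^ 2 with hE
  have hElow : ∀ t, 0 < t → κ ^ 2 * t ^ 2 ≤ E t := by
    intro t ht
    have h1 : κ ^ 2 ≤ (1 + w t) ^ 2 := pow_le_pow_left₀ hκ.le (by linarith [(H t ht).1]) 2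
    have h2 := mul_le_mul_of_nonneg_left h1 (sq_nonneg t)
    have h3 : 0 ≤ α ^ 2 * s t ^ 2 := by positivity
    simp only [hE]; linarith
  have hdiv : ∀ t c x, 0 < t → 0 ≤ c → E t * x ≤ c → x ≤ c / κ ^ 2 / t ^ 2 := by
    intro t c x ht hc hx
    rw [div_div, le_div_iff₀ (by positivity)]
    rcases le_or_gt x 0 with hx0 | hx0
    · have : x * (κ ^ 2 * t ^ 2) ≤ 0 := mul_nonpos_of_nonpos_of_nonneg hx0 (by positivity)
      linarith
    · have := mul_le_mul_of_nonneg_left (hElow t ht) hx0.le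
      linarith
  have hEV : ∀ t, 0 < t → E t * V' t = m * t ^ 2 * (1 + w t) * w t +
      α ^ 2 * (d - 1) * s t ^ 2 * w t + α * m * s t ^ 2 := by
    intro t ht
    have h1 := (H t ht).2.2.2.1
    simp only [hE, hV']
    linear_combination -h1 - α * s t ^ 2 * hw0d
  have hwb : ∀ t, 0 < t → 0 ≤ 1 + w t := fun t ht => by linarith [(H t ht).1]
  -- Step 1: boundedness
  set C1 := α * m / κ ^ 2 with hC1
  have hC1pos : 0 < C1 := by positivity
  have hVbound : ∀ t, 1 ≤ t → V t ≤ V 1 + C1 := by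
    have hder : ∀ t, 0 < t → HasDerivAt (fun t => V t + C1 * t⁻¹)
        (V' t + C1 * (-(t ^ 2)⁻¹)) t := fun t ht =>
      (hVd t).add ((hasDerivAt_inv ht.ne').const_mul C1)
    have hanti : AntitoneOn (fun t => V t + C1 * t⁻¹) (Ici 1) := by
      apply antitoneOn_of_deriv_nonpos (convex_Ici 1)
      · exact fun t ht => (hder t (lt_of_lt_of_le one_pos ht)).continuousAt.continuousWithinAt
      · intro t ht
        rw [interior_Ici] at ht
        exact (hder t (one_pos.trans ht)).differentiableAt.differentiableWithinAt
      intro t ht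
      rw [interior_Ici] at ht
      have ht : 0 < t := one_pos.trans ht
      rw [(hder t ht).deriv]
      obtain ⟨a1, a2, a3, -, -⟩ := H t ht
      have h1 : V' t ≤ α * m / κ ^ 2 / t ^ 2 := by
        apply hdiv t _ _ ht (by positivity)
        rw [hEV t ht]
        have h2 : 0 ≤ m * t ^ 2 * (1 + w t) * (-w t) :=
          mul_nonneg (mul_nonneg (by positivity) (hwb t ht)) (by linarith)
        have h3 : 0 ≤ α ^ 2 * (d - 1) * s t ^ 2 * (-w t) :=
          mul_nonneg (mul_nonneg (mul_nonneg (by positivity) (by linarith)) (by positivity))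
            (by linarith)
        have h4 : s t ^ 2 ≤ 1 := pow_le_one₀ (hspos t).le a3
        have h5 := mul_le_mul_of_nonneg_left h4 (by positivity : 0 ≤ α * m)
        linarith
      rw [div_eq_mul_inv _ (t ^ 2)] at h1
      linarith
    intro t ht
    have h1 := hanti (mem_Ici.2 le_rfl) (mem_Ici.2 ht) ht
    simp only [inv_one, mul_one] at h1
    have : 0 < t := one_pos.trans_le ht
    have : 0 ≤ C1 * t⁻¹ := by positivity
    linarith
  set B := V 1 + C1 with hB
  have hBpos : 0 < B := by have := hV0 1 one_pos; linarith
  set C2 := m * α ^ 2 + α * m + (m * α ^ 2 + B * (α * (d - 1))) with hC2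
  have hd0 : 0 ≤ α * ((d:ℝ) - 1) := mul_nonneg hα.le (by linarith)
  have hC2pos : 0 < C2 := by have := mul_nonneg hBpos.le hd0; positivity
  set C := C2 / κ ^ 2 with hC
  have hkey : ∀ t, 1 ≤ t → m * (V t + s t) / t + V' t + deriv s t ≤ C * (V t + s t) / t ^ 2 := by
    intro t ht1
    have ht : 0 < t := one_pos.trans_le ht1
    obtain ⟨a1, a2, a3, -, a5⟩ := H t ht
    have hsp := hspos t
    have hv0 := hV0 t ht
    have hs2 : s t ^ 2 ≤ s t := by nlinarith
    have h1 : m * (V t + s t) / t + V' t + deriv s t ≤ C2 * s t / κ ^ 2 / t ^ 2 := by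
      apply hdiv t _ _ ht (by positivity)
      have e1 : E t * (m * (V t + s t) / t + V' t + deriv s t) =
          -m * t ^ 2 * (1 + w t) * w t ^ 2 - m * w t * α ^ 2 * s t ^ 2
          + α ^ 2 * (d - 1) * s t ^ 2 * w t + α * m * s t ^ 2
          + s t * (m * t * (1 + w t) * w t + α * m * t * w t
            + m * α ^ 2 * (s t ^ 2 / t) + (1 + w t) * (α * (d - 1)) * V t) := by
        have e2 : E t * deriv s t = _ := a5
        rw [mul_add, mul_add, hEV t ht, e2]
        simp only [hE, hV]
        field_simp
        ring
      rw [e1]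
      have b1 : 0 ≤ m * t ^ 2 * (1 + w t) * w t ^ 2 :=
        mul_nonneg (mul_nonneg (by positivity) (hwb t ht)) (by positivity)
      have b2 : m * α ^ 2 * s t ^ 2 * (-w t) ≤ m * α ^ 2 * s t ^ 2 * 1 := by
        gcongr; linarith
      have b3 : 0 ≤ α ^ 2 * (d - 1) * s t ^ 2 * (-w t) :=
        mul_nonneg (mul_nonneg (mul_nonneg (by positivity) (by linarith)) (by positivity))
          (by linarith)
      have b4 : (m * α ^ 2 + α * m) * s t ^ 2 ≤ (m * α ^ 2 + α * m) * s t := by gcongr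
      have b5 : 0 ≤ m * t * (1 + w t) * (-w t) :=
        mul_nonneg (mul_nonneg (by positivity) (hwb t ht)) (by linarith)
      have b6 : 0 ≤ α * m * t * (-w t) := mul_nonneg (by positivity) (by linarith)
      have b7 : s t ^ 2 / t ≤ 1 := by
        rw [div_le_one ht]; nlinarith
      have b8 : m * α ^ 2 * (s t ^ 2 / t) ≤ m * α ^ 2 * 1 := by gcongr
      have b9 : (1 + w t) * (α * (d - 1)) * V t ≤ 1 * (α * (d - 1)) * B := by
        have := hVbound t ht1
        have := hwb t ht
        gcongr
        linarith
      have b10 : s t * (m * t * (1 + w t) * w t + α * m * t * w t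
            + m * α ^ 2 * (s t ^ 2 / t) + (1 + w t) * (α * (d - 1)) * V t) ≤
            s t * (m * α ^ 2 + B * (α * (d - 1))) := by
        apply mul_le_mul_of_nonneg_left _ hsp.le
        linarith
      simp only [hC2]
      linarith
    refine h1.trans ?_
    rw [hC, div_mul_eq_mul_div]
    gcongr
    linarith
  -- Step 2: weighted bound
  have hder : ∀ t, 0 < t → HasDerivAt (fun t => t ^ m * (V t + s t) * Real.exp (C * t⁻¹))
      ((m * t ^ (m - 1) * (V t + s t) + t ^ m * (V' t + deriv s t)) * Real.exp (C * t⁻¹) +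
        t ^ m * (V t + s t) * (Real.exp (C * t⁻¹) * (C * (-(t ^ 2)⁻¹)))) t := by
    intro t ht
    exact ((Real.hasDerivAt_rpow_const (Or.inl ht.ne')).mul
      ((hVd t).add (hs t).hasDerivAt)).mul ((hasDerivAt_inv ht.ne').const_mul C).exp
  have hanti : AntitoneOn (fun t => t ^ m * (V t + s t) * Real.exp (C * t⁻¹)) (Ici 1) := by
    apply antitoneOn_of_deriv_nonpos (convex_Ici 1)
    · exact fun t ht => (hder t (lt_of_lt_of_le one_pos ht)).continuousAt.continuousWithinAt
    · intro t ht
      rw [interior_Ici] at ht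
      exact (hder t (one_pos.trans ht)).differentiableAt.differentiableWithinAt
    intro t ht
    rw [interior_Ici] at ht
    have ht1 : 1 ≤ t := le_of_lt ht
    have ht : 0 < t := one_pos.trans_le ht1
    rw [(hder t ht).deriv, Real.rpow_sub_one ht.ne']
    have h1 := hkey t ht1
    have h2 : 0 ≤ t ^ m * Real.exp (C * t⁻¹) := by positivity
    have h3 : t ^ m * Real.exp (C * t⁻¹) * (m * (V t + s t) / t + V' t + deriv s t -
        C * (V t + s t) / t ^ 2) ≤ 0 := mul_nonpos_of_nonneg_of_nonpos h2 (by linarith)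
    refine le_of_eq_of_le ?_ h3
    field_simp
    ring
  refine ⟨(V 1 + s 1) * Real.exp C, ?_, ?_⟩
  · have := hV0 1 one_pos
    have := hspos 1
    positivity
  intro t ht1
  have ht : 0 < t := one_pos.trans_le ht1
  have h1 := hanti (mem_Ici.2 le_rfl) (mem_Ici.2 ht1) ht1
  simp only [inv_one, mul_one, Real.one_rpow, one_mul] at h1
  have h2 : |t * w t| + |s t| = V t + s t := by
    rw [← abs_neg (t * w t), abs_of_nonneg (hV0 t ht), abs_of_pos (hspos t)]
  rw [h2, Real.rpow_neg ht.le, ← div_eq_mul_inv, le_div_iff₀ (by positivity)]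
  have h3 : 1 ≤ Real.exp (C * t⁻¹) := Real.one_le_exp (by positivity)
  have h4 : 0 ≤ t ^ m * (V t + s t) := by
    have := hV0 t ht
    have := hspos t
    positivity
  have h5 := mul_le_mul_of_nonneg_left h3 h4
  linarith

end Aux

/-- The smooth self-similar profile `(U_R, S)` of the main theorem can moreover be chosen
with the polynomial decay `|U_R ζ| + |S ζ| ≤ C ζ^{-(r-1)}` for `ζ ≥ 1`. -/
theorem focusing_NLS_selfsimilar_profile_decay
    (d : ℕ) (hd : 1 ≤ d) (p : ℕ) (hp3 : 3 ≤ p) (hpodd : Odd p)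
    (α : ℝ) (hα : α = ((p : ℝ) - 1) / 4)
    (r : ℝ) (hr : 1 < r) (hrd : α * d > r - 1) :
    ∃ U S : ℝ → ℝ,
      ContDiff ℝ (⊤ : ℕ∞) U ∧ ContDiff ℝ (⊤ : ℕ∞) S ∧
      (∀ ζ : ℝ, U (-ζ) = -U ζ) ∧ (∀ ζ : ℝ, S (-ζ) = S ζ) ∧
      (∀ ζ : ℝ, 0 < S ζ) ∧ S 0 = 1 ∧ U 0 = 0 ∧
      deriv U 0 = -(r - 1) / (α * d) ∧
      (∀ ζ : ℝ, 0 < ζ →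
        0 = -(r - 1) * U ζ - ζ * deriv U ζ - U ζ * deriv U ζ + α * S ζ * deriv S ζ ∧
        0 = -(r - 1) * S ζ - ζ * deriv S ζ - deriv S ζ * U ζ - α * S ζ * deriv U ζ
              - α * ((d : ℝ) - 1) * S ζ * U ζ / ζ) ∧
      Filter.Tendsto U Filter.atTop (nhds 0) ∧
      Filter.Tendsto S Filter.atTop (nhds 0) ∧
      ∃ C : ℝ, 0 < C ∧ ∀ ζ : ℝ, 1 ≤ ζ → |U ζ| + |S ζ| ≤ C * ζ ^ (-(r - 1)) := by
  have hp : (3:ℝ) ≤ p := by exact_mod_cast hp3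
  have hαpos : 0 < α := by rw [hα]; linarith
  obtain ⟨m, hm⟩ : ∃ m, m = r - 1 := ⟨_, rfl⟩
  have hmpos : 0 < m := by linarith
  rw [← hm] at hrd ⊢
  have hd1 : (1:ℝ) ≤ d := by exact_mod_cast hd
  have hαd : 0 < α * d := by positivity
  obtain ⟨w0, hw0⟩ : ∃ w0, w0 = -m / (α * d) := ⟨_, rfl⟩
  have hw0d : α * d * w0 = -m := by rw [hw0]; field_simp
  have hκ : 0 < 1 + w0 := by
    by_contra hcon
    have h1 : α * d * (1 + w0) ≤ 0 := mul_nonpos_of_nonneg_of_nonpos hαd.le (by linarith)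
    nlinarith
  obtain ⟨w, s, hws, hss, hwe, hse, hw00, hs00, hspos, H⟩ :=
    profile_exists d hd α m hαpos hmpos hrd w0 hw0
  have hwd : Differentiable ℝ w := hws.differentiable (by simp)
  have hsd : Differentiable ℝ s := hss.differentiable (by simp)
  obtain ⟨C, hC, hdecay⟩ := profile_decay d hd α m hαpos hmpos w0 hw0d hκ w s hwd hsd hspos H
  have hUd : ∀ t, deriv (fun t => t * w t) t = w t + t * deriv w t := by
    intro t
    refine (((hasDerivAt_id t).mul (hwd t).hasDerivAt).congr_deriv ?_).deriv
    simp
  have hlim : Filter.Tendsto (fun t : ℝ => C * t ^ (-m)) Filter.atTop (nhds 0) := by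
    simpa using (tendsto_rpow_neg_atTop hmpos).const_mul C
  refine ⟨fun t => t * w t, s, contDiff_id.mul hws, hss, ?_, hse, hspos, hs00, by simp, ?_, ?_,
    ?_, ?_, C, hC, hdecay⟩
  · intro t
    simp only [hwe]; ring
  · rw [hUd, hw00, hw0]; simp
  · intro t ht
    obtain ⟨-, -, -, h4, h5⟩ := H t ht
    rw [hUd]
    have hsp := hspos t
    have hE : t ^ 2 * (1 + w t) ^ 2 + α ^ 2 * s t ^ 2 ≠ 0 := by positivity
    have hq : α * ((d : ℝ) - 1) * s t * (t * w t) / t = α * ((d : ℝ) - 1) * s t * w t := by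
      field_simp
    constructor
    · apply mul_left_cancel₀ hE
      simp only []
      linear_combination (t * (1 + w t)) * h4 - (α * s t) * h5
        + (1 + w t) * t * α * s t ^ 2 * hw0d
    · apply mul_left_cancel₀ hE
      simp only []
      rw [hq]
      linear_combination (α * s t) * h4 + (t * (1 + w t)) * h5 + α ^ 2 * s t ^ 3 * hw0d
  · refine squeeze_zero_norm' ?_ hlim
    filter_upwards [Filter.eventually_ge_atTop (1:ℝ)] with t ht
    have := hdecay t ht
    rw [Real.norm_eq_abs]
    linarith [abs_nonneg (s t)]
  · refine squeeze_zero_norm' ?_ hlim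
    filter_upwards [Filter.eventually_ge_atTop (1:ℝ)] with t ht
    have := hdecay t ht
    rw [Real.norm_eq_abs]
    linarith [abs_nonneg (t * w t)]
end
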